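/- arXiv:math/9904003 — 2 statements merged into one kernel-verified Lean document; each statement's English description precedes it below -/
import Mathlib

section
/- Let A be a commutative ring, and let M, N be filtered A-modules with decreasing filtrations M_i, N_j such that M_0 = M, N_0 = N. If Tor_1^A(gr_i M, gr_j N) = 0 for all i, j, then for the natural filtration on M ⊗_A N given by F^k(M ⊗ N) = Σ_{i+j=k} Im(M_i ⊗ N_j), the canonical map ⊕_{i+j=k} gr_i M ⊗_A gr_j N → gr_k(M ⊗_A N) is an isomorphism for every k (assuming the filtration of M is finite, or working degreewise as in the paper). -/
open CategoryTheory TensorProduct DirectSum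

variable {A M N : Type} [CommRing A] [AddCommGroup M] [Module A M]
  [AddCommGroup N] [Module A N]

/-- The `i`-th graded piece `gr_i M = M_i / M_{i+1}` of a decreasingly filtered module. -/
abbrev filGr (FM : ℕ → Submodule A M) (i : ℕ) :=
  FM i ⧸ (Submodule.comap (FM i).subtype (FM (i + 1)))

/-- The natural filtration `F^k(M ⊗ N) = Σ_{i+j=k} Im(M_i ⊗ N_j)` on a tensor product of
filtered modules. -/
noncomputable def tensorFil (FM : ℕ → Submodule A M) (FN : ℕ → Submodule A N) (k : ℕ) :
    Submodule A (M ⊗[A] N) :=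
  ⨆ p : {p : ℕ × ℕ // p.1 + p.2 = k},
    LinearMap.range (TensorProduct.map (FM p.1.1).subtype (FN p.1.2).subtype)

/-- The canonical map `⊕_{i+j=k} M_i ⊗ N_j → (M ⊗ N)/F^{k+1}(M ⊗ N)`,
whose image is `gr_k(M ⊗ N)`. -/
noncomputable def tensorGrMap (FM : ℕ → Submodule A M) (FN : ℕ → Submodule A N) (k : ℕ) :
    (⨁ i : Fin (k + 1), (↥(FM (i : ℕ)) ⊗[A] ↥(FN (k - (i : ℕ))))) →ₗ[A]
      ((M ⊗[A] N) ⧸ tensorFil FM FN (k + 1)) :=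
  DirectSum.toModule A (Fin (k + 1)) _ fun i =>
    (tensorFil FM FN (k + 1)).mkQ ∘ₗ
      TensorProduct.map (FM (i : ℕ)).subtype (FN (k - (i : ℕ))).subtype

/-- If a projective presentation `R₂ → R₁ → R₀ → Q` stays exact at `R₁` after tensoring with `P`,
then tensoring with `P` preserves injectivity of any `f : K → F` with cokernel `Q`. -/
theorem lTensor_injective_of_exact_presentation {A P R₂ R₁ R₀ K F Q : Type*} [CommRing A]
    [AddCommGroup P] [Module A P] [AddCommGroup R₂] [Module A R₂] [AddCommGroup R₁] [Module A R₁]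
    [AddCommGroup R₀] [Module A R₀] [AddCommGroup K] [Module A K] [AddCommGroup F] [Module A F]
    [AddCommGroup Q] [Module A Q] [Module.Projective A R₀]
    (d₂ : R₂ →ₗ[A] R₁) (d₁ : R₁ →ₗ[A] R₀) (π : R₀ →ₗ[A] Q)
    (hd : ∀ x, d₁ (d₂ x) = 0) (hπ : Function.Exact d₁ π) (hπs : Function.Surjective π)
    (hP : Function.Exact (d₂.lTensor P) (d₁.lTensor P))
    (f : K →ₗ[A] F) (g : F →ₗ[A] Q) (hf : Function.Injective f) (hfg : Function.Exact f g)
    (hg : Function.Surjective g) :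
    Function.Injective (f.lTensor P) := by
  obtain ⟨h₀, hh₀⟩ := Module.projective_lifting_property g π hg
  have hh₀' : ∀ r, g (h₀ r) = π r := fun r => LinearMap.congr_fun hh₀ r
  have hr : ∀ r, h₀ (d₁ r) ∈ LinearMap.range f := fun r =>
    (hfg _).1 (by rw [hh₀', hπ.apply_apply_eq_zero])
  let h₁ : R₁ →ₗ[A] K :=
    (LinearEquiv.ofInjective f hf).symm.toLinearMap ∘ₗ (h₀ ∘ₗ d₁).codRestrict _ hr
  have hh₁ : ∀ r, f (h₁ r) = h₀ (d₁ r) := fun r => by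
    have := (LinearEquiv.ofInjective f hf).apply_symm_apply ⟨h₀ (d₁ r), hr r⟩
    exact congrArg Subtype.val this
  have h₁d : h₁ ∘ₗ d₂ = 0 := by
    ext x
    apply hf
    simp [hh₁, hd]
  let a : R₁ →ₗ[A] K × R₀ := h₁.prod (-d₁)
  let b : K × R₀ →ₗ[A] F := f.coprod h₀
  have hab : Function.Exact a b := by
    rintro ⟨x, r⟩
    constructor
    · intro h
      have h' : f x + h₀ r = 0 := by simpa [b] using h
      have hr0 : π r = 0 := by
        rw [← hh₀', eq_neg_of_add_eq_zero_right h', map_neg, hfg.apply_apply_eq_zero, neg_zero]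
      obtain ⟨s, rfl⟩ := (hπ r).1 hr0
      refine ⟨-s, Prod.ext (hf ?_) (by simp [a])⟩
      simpa [a, hh₁] using (eq_neg_of_add_eq_zero_left h').symm
    · rintro ⟨s, hs⟩
      rw [← hs]
      simp [a, b, hh₁]
  have hb : Function.Surjective b := by
    intro y
    obtain ⟨r, hr⟩ := hπs (g y)
    obtain ⟨x, hx⟩ := (hfg (y - h₀ r)).1 (by rw [map_sub, hh₀', hr, sub_self])
    exact ⟨(x, r), by simp [b, hx]⟩
  rw [injective_iff_map_eq_zero]
  intro z hz
  obtain ⟨w, hw⟩ := (lTensor_exact P hab hb ((LinearMap.inl A K R₀).lTensor P z)).1 (by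
    rw [← LinearMap.comp_apply, ← LinearMap.lTensor_comp, LinearMap.coprod_inl, hz])
  have h2 := congrArg ((LinearMap.snd A K R₀).lTensor P) hw
  have h1 := congrArg ((LinearMap.fst A K R₀).lTensor P) hw
  simp only [← LinearMap.comp_apply, ← LinearMap.lTensor_comp, a, LinearMap.fst_prod,
    LinearMap.snd_prod, LinearMap.fst_comp_inl, LinearMap.snd_comp_inl, LinearMap.lTensor_zero,
    LinearMap.lTensor_neg, LinearMap.lTensor_id, LinearMap.neg_apply, LinearMap.zero_apply,
    LinearMap.id_apply, neg_eq_zero] at h1 h2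
  obtain ⟨v, rfl⟩ := (hP w).1 h2
  rw [← h1, ← LinearMap.comp_apply, ← LinearMap.lTensor_comp, h₁d, LinearMap.lTensor_zero,
    LinearMap.zero_apply]

/-- If `Tor₁(P, Q) = 0`, then tensoring with `P` preserves injectivity of any `f : K → F` with
cokernel `Q`. -/
theorem lTensor_injective_of_subsingleton_tor {A P Q K F : Type} [CommRing A]
    [AddCommGroup P] [Module A P] [AddCommGroup Q] [Module A Q]
    [AddCommGroup K] [Module A K] [AddCommGroup F] [Module A F]
    (htor : Subsingleton ((((Tor (ModuleCat A) 1).obj (ModuleCat.of A P)).obj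
      (ModuleCat.of A Q) : ModuleCat A)))
    (f : K →ₗ[A] F) (g : F →ₗ[A] Q) (hf : Function.Injective f) (hfg : Function.Exact f g)
    (hg : Function.Surjective g) :
    Function.Injective (f.lTensor P) := by
  let R := projectiveResolution (ModuleCat.of A Q)
  let T := (MonoidalCategory.tensoringLeft (ModuleCat A)).obj (ModuleCat.of A P)
  have hex : ((T.mapHomologicalComplex _).obj R.complex).ExactAt 1 := by
    rw [HomologicalComplex.exactAt_iff_isZero_homology]
    exact (@ModuleCat.isZero_of_subsingleton _ _ _ htor).of_iso (R.isoLeftDerivedObj T 1).symm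
  rw [HomologicalComplex.exactAt_iff' _ 2 1 0 (by simp) (by simp),
    ShortComplex.ShortExact.moduleCat_exact_iff_function_exact] at hex
  have h0 := (ShortComplex.ShortExact.moduleCat_exact_iff_function_exact _).1 R.exact₀
  have : Module.Projective A (R.complex.X 0) :=
    (IsProjective.iff_projective _).2 (R.projective 0)
  have hs : Function.Surjective (R.π.f 0) := (ModuleCat.epi_iff_surjective _).1 inferInstance
  refine lTensor_injective_of_exact_presentation (R.complex.d 2 1).hom (R.complex.d 1 0).hom
    (R.π.f 0).hom (fun x => ?_) h0 hs hex f g hf hfg hg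
  rw [← LinearMap.comp_apply, ← ModuleCat.hom_comp, R.complex.d_comp_d]
  rfl

/-- A snake-lemma argument: if `P ⊗ K → P ⊗ F` is injective with `F` flat, then tensoring a
submodule `i : L' → L` with quotient `P` by `F / K` is injective. -/
theorem rTensor_injective_of_lTensor_injective {A L' L P K F Q : Type*} [CommRing A]
    [AddCommGroup L'] [Module A L'] [AddCommGroup L] [Module A L]
    [AddCommGroup P] [Module A P] [AddCommGroup Q] [Module A Q]
    [AddCommGroup K] [Module A K] [AddCommGroup F] [Module A F] [Module.Flat A F]
    (i : L' →ₗ[A] L) (p : L →ₗ[A] P) (hi : Function.Injective i) (hip : Function.Exact i p)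
    (hp : Function.Surjective p)
    (f : K →ₗ[A] F) (g : F →ₗ[A] Q) (hfg : Function.Exact f g) (hg : Function.Surjective g)
    (hinj : Function.Injective (f.lTensor P)) :
    Function.Injective (i.rTensor Q) := by
  rw [injective_iff_map_eq_zero]
  intro z hz
  obtain ⟨y, rfl⟩ := LinearMap.lTensor_surjective L' hg z
  obtain ⟨w, hw⟩ := (lTensor_exact L hfg hg (i.rTensor F y)).1 (by
    rw [← hz, ← LinearMap.comp_apply, ← LinearMap.comp_apply, LinearMap.lTensor_comp_rTensor,
      LinearMap.rTensor_comp_lTensor])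
  have hpw : p.rTensor K w = 0 := by
    apply hinj
    rw [map_zero, ← LinearMap.comp_apply, LinearMap.lTensor_comp_rTensor,
      ← LinearMap.rTensor_comp_lTensor, LinearMap.comp_apply, hw]
    exact (rTensor_exact F hip hp).apply_apply_eq_zero y
  obtain ⟨w', rfl⟩ := (rTensor_exact K hip hp w).1 hpw
  have hy : f.lTensor L' w' = y := by
    apply Module.Flat.rTensor_preserves_injective_linearMap (M := F) i hi
    rw [← hw, ← LinearMap.comp_apply, ← LinearMap.comp_apply, LinearMap.lTensor_comp_rTensor,
      LinearMap.rTensor_comp_lTensor]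
  rw [← hy]
  exact (lTensor_exact L' hfg hg).apply_apply_eq_zero w'

/-- If tensoring with `P` preserves injectivity of each inclusion `G (j + 1) → G j`, then it
preserves injectivity of the inclusions `G m → G 0 = F`. -/
theorem lTensor_subtype_injective_of_inclusion {A P F : Type*} [CommRing A]
    [AddCommGroup P] [Module A P] [AddCommGroup F] [Module A F] (G : ℕ → Submodule A F)
    (hG0 : G 0 = ⊤) (hG : ∀ j, G (j + 1) ≤ G j)
    (hinj : ∀ j, Function.Injective ((Submodule.inclusion (hG j)).lTensor P)) (m : ℕ) :
    Function.Injective ((G m).subtype.lTensor P) := by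
  induction m with
  | zero =>
    have hb : Function.Bijective (G 0).subtype :=
      ⟨Subtype.val_injective, fun x => ⟨⟨x, hG0 ▸ Submodule.mem_top⟩, rfl⟩⟩
    exact (LinearEquiv.lTensor P (LinearEquiv.ofBijective _ hb)).injective
  | succ m ih =>
    have : (G (m + 1)).subtype = (G m).subtype ∘ₗ Submodule.inclusion (hG m) := rfl
    rw [this, LinearMap.lTensor_comp]
    exact ih.comp (hinj m)

/-- Vanishing of `Tor₁(P, gr_j N)` makes `P ⊗ G_m → P ⊗ F` injective for the filtration `G` induced
on a module `F` surjecting onto `N`. -/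
theorem lTensor_comap_subtype_injective {A P N F : Type} [CommRing A]
    [AddCommGroup P] [Module A P] [AddCommGroup N] [Module A N] [AddCommGroup F] [Module A F]
    (FN : ℕ → Submodule A N) (hFN0 : FN 0 = ⊤) (hFN : ∀ j, FN (j + 1) ≤ FN j)
    (htor : ∀ j, Subsingleton ((((Tor (ModuleCat A) 1).obj (ModuleCat.of A P)).obj
      (ModuleCat.of A (filGr FN j)) : ModuleCat A)))
    (p : F →ₗ[A] N) (hp : Function.Surjective p) (m : ℕ) :
    Function.Injective (((FN m).comap p).subtype.lTensor P) := by
  refine lTensor_subtype_injective_of_inclusion (fun j => (FN j).comap p) (by simp [hFN0])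
    (fun j => Submodule.comap_mono (hFN j)) (fun j => ?_) m
  let q : (FN j).comap p →ₗ[A] FN j := p.restrict fun _ hx => hx
  refine lTensor_injective_of_subsingleton_tor (htor j) _ (Submodule.mkQ _ ∘ₗ q)
    (Submodule.inclusion_injective _) ?_ ((Submodule.mkQ_surjective _).comp ?_)
  · intro x
    constructor
    · intro h
      have hx : q x ∈ (FN (j + 1)).comap (FN j).subtype := (Submodule.Quotient.mk_eq_zero _).1 h
      exact ⟨⟨x, hx⟩, rfl⟩
    · rintro ⟨y, rfl⟩
      have hy : q (Submodule.inclusion (Submodule.comap_mono (hFN j)) y) ∈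
        (FN (j + 1)).comap (FN j).subtype := y.2
      exact (Submodule.Quotient.mk_eq_zero _).2 hy
  · rintro ⟨y, hy⟩
    obtain ⟨x, rfl⟩ := hp y
    exact ⟨⟨x, hy⟩, rfl⟩

/-- If `P ⊗ J → P ⊗ N` is injective, where `P = L / L'`, and `J' ≤ J`, then an element of `L ⊗ J`
whose image in `L ⊗ (N / J')` comes from `L' ⊗ (N / J')` is a sum of elements coming from `L ⊗ J'`
and from `L' ⊗ J`. -/
theorem exists_add_eq_of_lTensor_mkQ_mem {A L' L P N : Type*} [CommRing A]
    [AddCommGroup L'] [Module A L'] [AddCommGroup L] [Module A L]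
    [AddCommGroup P] [Module A P] [AddCommGroup N] [Module A N]
    (i : L' →ₗ[A] L) (p : L →ₗ[A] P) (hip : Function.Exact i p) (hp : Function.Surjective p)
    (J J' : Submodule A N) (hJ : J' ≤ J) (hinj : Function.Injective (J.subtype.lTensor P))
    (z : L ⊗[A] J) (u : L' ⊗[A] (N ⧸ J'))
    (hz : (J'.mkQ ∘ₗ J.subtype).lTensor L z = i.rTensor _ u) :
    ∃ (c : L ⊗[A] J') (d : L' ⊗[A] J),
      (Submodule.inclusion hJ).lTensor L c + i.rTensor J d = z := by
  have h1 : J'.mkQ.lTensor P (p.rTensor N (J.subtype.lTensor L z)) = 0 := by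
    rw [← LinearMap.comp_apply, LinearMap.lTensor_comp_rTensor, ← LinearMap.rTensor_comp_lTensor,
      LinearMap.comp_apply, ← LinearMap.comp_apply (J'.mkQ.lTensor L), ← LinearMap.lTensor_comp, hz]
    exact (rTensor_exact _ hip hp).apply_apply_eq_zero u
  obtain ⟨w, hw⟩ := (lTensor_exact P (LinearMap.exact_subtype_mkQ J')
    (Submodule.mkQ_surjective J') _).1 h1
  obtain ⟨c, rfl⟩ := LinearMap.rTensor_surjective J' hp w
  have h2 : p.rTensor J (z - (Submodule.inclusion hJ).lTensor L c) = 0 := by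
    rw [map_sub, sub_eq_zero]
    apply hinj
    have e : J'.subtype = J.subtype ∘ₗ Submodule.inclusion hJ := rfl
    rw [← LinearMap.comp_apply, LinearMap.lTensor_comp_rTensor, ← LinearMap.rTensor_comp_lTensor,
      LinearMap.comp_apply, ← hw, e, LinearMap.lTensor_comp, LinearMap.comp_apply]
    congr 1
    rw [← LinearMap.comp_apply, ← LinearMap.comp_apply, LinearMap.lTensor_comp_rTensor,
      LinearMap.rTensor_comp_lTensor]
  obtain ⟨d, hd⟩ := (rTensor_exact J hip hp _).1 h2
  exact ⟨c, d, by rw [hd, add_sub_cancel]⟩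

/-- The canonical map `M_i ⊗ N_j → M ⊗ (N / N_m)`. -/
noncomputable def filTensorQuot (FM : ℕ → Submodule A M) (FN : ℕ → Submodule A N) (m i j : ℕ) :
    (FM i ⊗[A] FN j) →ₗ[A] M ⊗[A] (N ⧸ FN m) :=
  TensorProduct.map (FM i).subtype ((FN m).mkQ ∘ₗ (FN j).subtype)

/-- The sum of the images of `M_i ⊗ N_j` in `M ⊗ (N / N_m)` over `i + j = m` with `n ≤ i`. -/
noncomputable def filTensorQuotTail (FM : ℕ → Submodule A M) (FN : ℕ → Submodule A N) (m n : ℕ) :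
    Submodule A (M ⊗[A] (N ⧸ FN m)) :=
  ⨆ p : {p : ℕ × ℕ // p.1 + p.2 = m ∧ n ≤ p.1},
    LinearMap.range (filTensorQuot FM FN m p.1.1 p.1.2)

theorem filTensorQuot_mem_tail (FM : ℕ → Submodule A M) (FN : ℕ → Submodule A N) {m n i j : ℕ}
    (hij : i + j = m) (hn : n ≤ i) (z : FM i ⊗[A] FN j) :
    filTensorQuot FM FN m i j z ∈ filTensorQuotTail FM FN m n :=
  le_iSup (fun p : {p : ℕ × ℕ // p.1 + p.2 = m ∧ n ≤ p.1} =>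
    LinearMap.range (filTensorQuot FM FN m p.1.1 p.1.2)) ⟨(i, j), hij, hn⟩ ⟨z, rfl⟩

theorem filTensorQuotTail_le_sup (FM : ℕ → Submodule A M) (FN : ℕ → Submodule A N) {k n : ℕ}
    (hn : n ≤ k) :
    filTensorQuotTail FM FN (k + 1) n ≤
      LinearMap.range (filTensorQuot FM FN (k + 1) n (k - n + 1)) ⊔
        filTensorQuotTail FM FN (k + 1) (n + 1) := by
  refine iSup_le ?_
  rintro ⟨⟨i, j⟩, hij, hi⟩
  dsimp only at hij hi ⊢
  rcases hi.eq_or_lt with rfl | hlt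
  · obtain rfl : j = k - n + 1 := by omega
    exact le_sup_left
  · rintro _ ⟨z, rfl⟩
    exact Submodule.mem_sup_right (filTensorQuot_mem_tail FM FN hij hlt z)

theorem range_filTensorQuot_le (FM : ℕ → Submodule A M) (FN : ℕ → Submodule A N)
    (hFM : Antitone FM) {m n i j : ℕ} (hn : n ≤ i) :
    LinearMap.range (filTensorQuot FM FN m i j) ≤
      LinearMap.range ((FM n).subtype.rTensor (N ⧸ FN m)) := by
  have e : filTensorQuot FM FN m i j = (FM n).subtype.rTensor (N ⧸ FN m) ∘ₗ
      TensorProduct.map (Submodule.inclusion (hFM hn)) ((FN m).mkQ ∘ₗ (FN j).subtype) := by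
    ext; rfl
  rw [e]
  exact LinearMap.range_comp_le_range _ _

theorem filTensorQuotTail_le (FM : ℕ → Submodule A M) (FN : ℕ → Submodule A N)
    (hFM : Antitone FM) (m n : ℕ) :
    filTensorQuotTail FM FN m n ≤ LinearMap.range ((FM n).subtype.rTensor (N ⧸ FN m)) :=
  iSup_le fun p => range_filTensorQuot_le FM FN hFM p.2.2

/-- The submodule of `M_i ⊗ N_j` generated by `M_{i+1} ⊗ N_j` and `M_i ⊗ N_{j+1}`, that is, the
kernel of `M_i ⊗ N_j → gr_i M ⊗ gr_j N`. -/
noncomputable def filTensorDeeper (FM : ℕ → Submodule A M) (FN : ℕ → Submodule A N)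
    (hFM : ∀ i, FM (i + 1) ≤ FM i) (hFN : ∀ j, FN (j + 1) ≤ FN j) (i j : ℕ) :
    Submodule A (FM i ⊗[A] FN j) :=
  LinearMap.range
      (TensorProduct.map (Submodule.inclusion (hFM i)) (LinearMap.id : FN j →ₗ[A] FN j)) ⊔
    LinearMap.range
      (TensorProduct.map (LinearMap.id : FM i →ₗ[A] FM i) (Submodule.inclusion (hFN j)))

/-- Peeling off the component of lowest `M`-degree from a relation modulo `F^{k+1}`. -/
theorem mem_filTensorDeeper_of_add_mem_tail (FM : ℕ → Submodule A M) (FN : ℕ → Submodule A N)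
    (hFM : ∀ i, FM (i + 1) ≤ FM i) (hFN : ∀ j, FN (j + 1) ≤ FN j) {k n : ℕ} (hn : n ≤ k)
    (hN : Function.Injective ((FN (k - n)).subtype.lTensor (filGr FM n)))
    (hM : Function.Injective ((FM n).subtype.rTensor (N ⧸ FN (k + 1))))
    (z : FM n ⊗[A] FN (k - n)) (s : M ⊗[A] (N ⧸ FN (k + 1)))
    (hs : s ∈ LinearMap.range ((FM (n + 1)).subtype.rTensor (N ⧸ FN (k + 1))))
    (hzs : filTensorQuot FM FN (k + 1) n (k - n) z + s ∈ filTensorQuotTail FM FN (k + 1) n) :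
    z ∈ filTensorDeeper FM FN hFM hFN n (k - n) ∧
      s ∈ filTensorQuotTail FM FN (k + 1) (n + 1) := by
  have hFM' : Antitone FM := antitone_nat_of_succ_le hFM
  have hFN' : Antitone FN := antitone_nat_of_succ_le hFN
  obtain ⟨_, ⟨e, rfl⟩, v, hv, hev⟩ := Submodule.mem_sup.1 (filTensorQuotTail_le_sup FM FN hn hzs)
  obtain ⟨u, hu⟩ := sub_mem (filTensorQuotTail_le FM FN hFM' _ _ hv) hs
  let e' : FM n ⊗[A] FN (k - n) := (Submodule.inclusion (hFN (k - n))).lTensor (FM n) e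
  have he' : filTensorQuot FM FN (k + 1) n (k - n) e' =
      filTensorQuot FM FN (k + 1) n (k - n + 1) e := by
    rw [← LinearMap.comp_apply]
    congr 1
    ext; rfl
  have hq : filTensorQuot FM FN (k + 1) n (k - n) = (FM n).subtype.rTensor _ ∘ₗ
      ((FN (k + 1)).mkQ ∘ₗ (FN (k - n)).subtype).lTensor (FM n) := by
    rw [LinearMap.rTensor_comp_lTensor]; rfl
  obtain ⟨c, d, hcd⟩ := exists_add_eq_of_lTensor_mkQ_mem (Submodule.inclusion (hFM n))
    (Submodule.mkQ ((FM (n + 1)).comap (FM n).subtype))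
    (by
      rw [LinearMap.exact_iff, Submodule.ker_mkQ, Submodule.range_inclusion])
    (Submodule.mkQ_surjective _) (FN (k - n)) (FN (k + 1)) (hFN' (by omega)) hN (z - e') u
    (by
      apply hM
      rw [← LinearMap.comp_apply, ← hq, map_sub, he', ← LinearMap.comp_apply,
        ← LinearMap.rTensor_comp, Submodule.subtype_comp_inclusion, hu, sub_eq_sub_iff_add_eq_add,
        ← hev, add_comm _ v])
  have hc : filTensorQuot FM FN (k + 1) n (k - n)
      ((Submodule.inclusion (hFN' (by omega : k - n ≤ k + 1))).lTensor (FM n) c) = 0 := by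
    have : filTensorQuot FM FN (k + 1) n (k - n) ∘ₗ
        (Submodule.inclusion (hFN' (by omega : k - n ≤ k + 1))).lTensor (FM n) = 0 := by
      ext x y
      have hy : (FN (k + 1)).mkQ (y : N) = 0 := (Submodule.Quotient.mk_eq_zero _).2 y.2
      change (x : M) ⊗ₜ[A] (FN (k + 1)).mkQ (y : N) = 0
      rw [hy, tmul_zero]
    exact LinearMap.congr_fun this c
  have hd : filTensorQuot FM FN (k + 1) n (k - n)
      ((Submodule.inclusion (hFM n)).rTensor _ d) =
        filTensorQuot FM FN (k + 1) (n + 1) (k - n) d := by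
    rw [← LinearMap.comp_apply]
    congr 1
    ext; rfl
  constructor
  · rw [eq_add_of_sub_eq hcd.symm]
    refine add_mem (add_mem ?_ (Submodule.mem_sup_left ⟨d, rfl⟩)) (Submodule.mem_sup_right ⟨e, rfl⟩)
    refine Submodule.mem_sup_right ⟨(Submodule.inclusion (hFN' (by omega))).lTensor (FM n) c, ?_⟩
    rw [← LinearMap.lTensor, ← LinearMap.comp_apply, ← LinearMap.lTensor_comp]
    rfl
  · have hs' : s = v - filTensorQuot FM FN (k + 1) (n + 1) (k - n) d := by
      have h1 := congrArg (filTensorQuot FM FN (k + 1) n (k - n)) hcd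
      rw [map_add, hc, hd, zero_add, map_sub, he'] at h1
      rw [h1, eq_sub_iff_add_eq, add_sub, sub_eq_iff_eq_add, add_comm s, ← hev, add_comm _ v]
    rw [hs']
    exact sub_mem hv (filTensorQuot_mem_tail FM FN (by omega) le_rfl d)

/-- The map `M_{i+1} ⊗ (N / N_m) → M_i ⊗ (N / N_m)` is injective when `Tor₁(gr_i M, gr_j N) = 0`
for all `j`, as one sees from a flat module `F` surjecting onto `N`. -/
theorem rTensor_inclusion_injective_of_tor {F : Type} [AddCommGroup F] [Module A F]
    [Module.Flat A F] (FM : ℕ → Submodule A M) (FN : ℕ → Submodule A N) (hFN0 : FN 0 = ⊤)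
    (hFM : ∀ i, FM (i + 1) ≤ FM i) (hFN : ∀ j, FN (j + 1) ≤ FN j) (i : ℕ)
    (htor : ∀ j, Subsingleton
      ((((Tor (ModuleCat A) 1).obj (ModuleCat.of A (filGr FM i))).obj
        (ModuleCat.of A (filGr FN j)) : ModuleCat A)))
    (p : F →ₗ[A] N) (hp : Function.Surjective p) (m : ℕ) :
    Function.Injective ((Submodule.inclusion (hFM i)).rTensor (N ⧸ FN m)) := by
  have hpm : Function.Exact ((FN m).comap p).subtype ((FN m).mkQ ∘ₗ p) := by
    rw [LinearMap.exact_iff, LinearMap.ker_comp, Submodule.ker_mkQ, Submodule.range_subtype]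
  exact rTensor_injective_of_lTensor_injective (Submodule.inclusion (hFM i))
    (Submodule.mkQ ((FM (i + 1)).comap (FM i).subtype)) (Submodule.inclusion_injective _)
    (by rw [LinearMap.exact_iff, Submodule.ker_mkQ, Submodule.range_inclusion])
    (Submodule.mkQ_surjective _) ((FN m).comap p).subtype ((FN m).mkQ ∘ₗ p) hpm
    ((Submodule.mkQ_surjective _).comp hp)
    (lTensor_comap_subtype_injective FN hFN0 hFN htor p hp m)

/-- The map `M_i ⊗ (N / N_m) → M ⊗ (N / N_m)` is injective when `Tor₁(gr_i M, gr_j N) = 0` for all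
`i, j`. -/
theorem rTensor_subtype_injective_of_tor (FM : ℕ → Submodule A M) (FN : ℕ → Submodule A N)
    (hFM0 : FM 0 = ⊤) (hFN0 : FN 0 = ⊤)
    (hFM : ∀ i, FM (i + 1) ≤ FM i) (hFN : ∀ j, FN (j + 1) ≤ FN j)
    (htor : ∀ i j, Subsingleton
      ((((Tor (ModuleCat A) 1).obj (ModuleCat.of A (filGr FM i))).obj
        (ModuleCat.of A (filGr FN j)) : ModuleCat A)))
    (m i : ℕ) :
    Function.Injective ((FM i).subtype.rTensor (N ⧸ FN m)) := by
  refine (LinearMap.lTensor_inj_iff_rTensor_inj _ _).1 ?_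
  refine lTensor_subtype_injective_of_inclusion FM hFM0 hFM (fun i => ?_) i
  rw [LinearMap.lTensor_inj_iff_rTensor_inj]
  exact rTensor_inclusion_injective_of_tor FM FN hFN0 hFM hFN i (htor i)
    (Finsupp.linearCombination A (id : N → N)) (Finsupp.linearCombination_id_surjective A N) m

/-- If a sum of elements of `M_i ⊗ N_{k-i}` lies in `F^{k+1}` modulo `N_{k+1}`, then each summand
vanishes in `gr_i M ⊗ gr_{k-i} N`. -/
theorem mem_filTensorDeeper_of_sum_mem_tail (FM : ℕ → Submodule A M) (FN : ℕ → Submodule A N)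
    (hFM : ∀ i, FM (i + 1) ≤ FM i) (hFN : ∀ j, FN (j + 1) ≤ FN j) (k : ℕ)
    (hN : ∀ i j, Function.Injective ((FN j).subtype.lTensor (filGr FM i)))
    (hM : ∀ i, Function.Injective ((FM i).subtype.rTensor (N ⧸ FN (k + 1))))
    (x : ∀ i : ℕ, FM i ⊗[A] FN (k - i))
    (hx : ∑ i ∈ Finset.Ico 0 (k + 1), filTensorQuot FM FN (k + 1) i (k - i) (x i) ∈
      filTensorQuotTail FM FN (k + 1) 0) (i : ℕ) (hi : i ≤ k) :
    x i ∈ filTensorDeeper FM FN hFM hFN i (k - i) := by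
  have step : ∀ n ≤ k,
      ∑ i ∈ Finset.Ico n (k + 1), filTensorQuot FM FN (k + 1) i (k - i) (x i) ∈
        filTensorQuotTail FM FN (k + 1) n →
      x n ∈ filTensorDeeper FM FN hFM hFN n (k - n) ∧
        ∑ i ∈ Finset.Ico (n + 1) (k + 1), filTensorQuot FM FN (k + 1) i (k - i) (x i) ∈
          filTensorQuotTail FM FN (k + 1) (n + 1) := by
    intro n hn h
    rw [Finset.sum_eq_sum_Ico_succ_bot (by omega)] at h
    refine mem_filTensorDeeper_of_add_mem_tail FM FN hFM hFN hn (hN _ _) (hM _) _ _ ?_ h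
    exact sum_mem fun i hi => range_filTensorQuot_le FM FN (antitone_nat_of_succ_le hFM)
      (Finset.mem_Ico.1 hi).1 ⟨_, rfl⟩
  have tail : ∀ n ≤ k,
      ∑ i ∈ Finset.Ico n (k + 1), filTensorQuot FM FN (k + 1) i (k - i) (x i) ∈
        filTensorQuotTail FM FN (k + 1) n := by
    intro n
    induction n with
    | zero => exact fun _ => hx
    | succ n ih => exact fun hn => (step n (by omega) (ih (by omega))).2
  exact (step i hi (tail i hi)).1

/-- The image of `F^m(M ⊗ N)` in `M ⊗ (N / N_m)` is the full sum of the images of `M_i ⊗ N_j`. -/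
theorem lTensor_mkQ_mem_tail (FM : ℕ → Submodule A M) (FN : ℕ → Submodule A N) (m : ℕ)
    {y : M ⊗[A] N} (hy : y ∈ tensorFil FM FN m) :
    (FN m).mkQ.lTensor M y ∈ filTensorQuotTail FM FN m 0 := by
  refine (iSup_le ?_ : tensorFil FM FN m ≤
    (filTensorQuotTail FM FN m 0).comap ((FN m).mkQ.lTensor M)) hy
  rintro ⟨⟨i, j⟩, hij⟩ _ ⟨z, rfl⟩
  have e : (FN m).mkQ.lTensor M ∘ₗ TensorProduct.map (FM i).subtype (FN j).subtype =
      filTensorQuot FM FN m i j := by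
    ext; rfl
  rw [Submodule.mem_comap, ← LinearMap.comp_apply, e]
  exact filTensorQuot_mem_tail FM FN hij (Nat.zero_le _) z

theorem map_subtype_mem_tensorFil (FM : ℕ → Submodule A M) (FN : ℕ → Submodule A N) {m i j : ℕ}
    (hij : i + j = m) (z : FM i ⊗[A] FN j) :
    TensorProduct.map (FM i).subtype (FN j).subtype z ∈ tensorFil FM FN m :=
  le_iSup (fun p : {p : ℕ × ℕ // p.1 + p.2 = m} =>
    LinearMap.range (TensorProduct.map (FM p.1.1).subtype (FN p.1.2).subtype)) ⟨(i, j), hij⟩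
    ⟨z, rfl⟩

/-- If `Tor₁(gr_i M, gr_j N) = 0` for all `i, j`, then the canonical map
`⊕_{i+j=k} gr_i M ⊗ gr_j N → gr_k(M ⊗ N)` is an isomorphism for every `k`.  This is
expressed by saying that the kernel of the canonical (automatically surjective onto
`gr_k(M ⊗ N)`) map `⊕_{i+j=k} M_i ⊗ N_j → (M ⊗ N)/F^{k+1}` is exactly the part coming
from the deeper filtration steps `M_{i+1} ⊗ N_j` and `M_i ⊗ N_{j+1}`. -/
theorem stmt1 (FM : ℕ → Submodule A M) (FN : ℕ → Submodule A N)
    (hFM0 : FM 0 = ⊤) (hFN0 : FN 0 = ⊤)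
    (hFM : ∀ i, FM (i + 1) ≤ FM i) (hFN : ∀ j, FN (j + 1) ≤ FN j)
    (ℓ : ℕ) (hfin : FM ℓ = ⊥)
    (htor : ∀ i j, Subsingleton
      ((((Tor (ModuleCat A) 1).obj (ModuleCat.of A (filGr FM i))).obj
        (ModuleCat.of A (filGr FN j)) : ModuleCat A)))
    (k : ℕ) :
    LinearMap.ker (tensorGrMap FM FN k) =
      ⨆ i : Fin (k + 1),
        (LinearMap.range ((DirectSum.lof A (Fin (k + 1))
              (fun i => (↥(FM (i : ℕ)) ⊗[A] ↥(FN (k - (i : ℕ))))) i) ∘ₗ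
            TensorProduct.map (Submodule.inclusion (hFM (i : ℕ))) LinearMap.id) ⊔
         LinearMap.range ((DirectSum.lof A (Fin (k + 1))
              (fun i => (↥(FM (i : ℕ)) ⊗[A] ↥(FN (k - (i : ℕ))))) i) ∘ₗ
            TensorProduct.map LinearMap.id (Submodule.inclusion (hFN (k - (i : ℕ)))))) := by
  apply le_antisymm
  · intro x hx
    have hsum : ∑ i : Fin (k + 1), TensorProduct.map (FM (i : ℕ)).subtype
        (FN (k - (i : ℕ))).subtype (x i) ∈ tensorFil FM FN (k + 1) := by
      rw [← Submodule.ker_mkQ (tensorFil FM FN (k + 1)), LinearMap.mem_ker, map_sum,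
        ← LinearMap.mem_ker.1 hx]
      conv_rhs => rw [← DirectSum.sum_univ_of x, map_sum]
      refine Finset.sum_congr rfl fun i _ => ?_
      exact (DirectSum.toModule_lof (φ := fun i : Fin (k + 1) =>
        (tensorFil FM FN (k + 1)).mkQ ∘ₗ
          TensorProduct.map (FM (i : ℕ)).subtype (FN (k - (i : ℕ))).subtype) A i (x i)).symm
    let x' : ∀ i : ℕ, FM i ⊗[A] FN (k - i) := fun i =>
      if h : i < k + 1 then x ⟨i, h⟩ else 0
    have hx' : ∀ i : Fin (k + 1), x' i = x i := fun i => dif_pos i.2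
    have htail : ∑ i ∈ Finset.Ico 0 (k + 1), filTensorQuot FM FN (k + 1) i (k - i) (x' i) ∈
        filTensorQuotTail FM FN (k + 1) 0 := by
      rw [← Finset.range_eq_Ico, Finset.sum_range]
      convert lTensor_mkQ_mem_tail FM FN (k + 1) hsum
      rw [map_sum]
      refine Finset.sum_congr rfl fun i _ => ?_
      rw [hx', ← LinearMap.comp_apply]
      congr 1
      ext; rfl
    have hN : ∀ i j, Function.Injective ((FN j).subtype.lTensor (filGr FM i)) := fun i j =>
      lTensor_comap_subtype_injective FN hFN0 hFN (htor i) LinearMap.id Function.surjective_id j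
    have key := mem_filTensorDeeper_of_sum_mem_tail FM FN hFM hFN k hN
      (rTensor_subtype_injective_of_tor FM FN hFM0 hFN0 hFM hFN htor (k + 1)) x' htail
    rw [← DirectSum.sum_univ_of x]
    refine sum_mem fun i _ => Submodule.mem_iSup_of_mem i ?_
    have hi := Submodule.mem_map_of_mem (f := DirectSum.lof A (Fin (k + 1))
      (fun i => (↥(FM (i : ℕ)) ⊗[A] ↥(FN (k - (i : ℕ))))) i) (key i (Nat.lt_succ_iff.1 i.2))
    rw [hx', filTensorDeeper, Submodule.map_sup, ← LinearMap.range_comp,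
      ← LinearMap.range_comp] at hi
    exact hi
  · refine iSup_le fun i => sup_le ?_ ?_
    · rintro _ ⟨z, rfl⟩
      rw [LinearMap.mem_ker, LinearMap.comp_apply, tensorGrMap, DirectSum.toModule_lof,
        LinearMap.comp_apply, ← LinearMap.comp_apply (TensorProduct.map _ _),
        ← TensorProduct.map_comp]
      exact (Submodule.Quotient.mk_eq_zero _).2
        (map_subtype_mem_tensorFil FM FN (i := i + 1) (j := k - i) (by omega) z)
    · rintro _ ⟨z, rfl⟩
      rw [LinearMap.mem_ker, LinearMap.comp_apply, tensorGrMap, DirectSum.toModule_lof,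
        LinearMap.comp_apply, ← LinearMap.comp_apply (TensorProduct.map _ _),
        ← TensorProduct.map_comp]
      exact (Submodule.Quotient.mk_eq_zero _).2
        (map_subtype_mem_tensorFil FM FN (i := i) (j := k - i + 1) (by omega) z)
end

section
/- Let K be a field, A and B two K-algebras, M an A-module and N a B-module. Then Tor_1^{A ⊗_K B}(M ⊗_K B, A ⊗_K N) = 0. -/
open CategoryTheory TensorProduct

attribute [local instance] Algebra.TensorProduct.rightAlgebra

/-- If `f`, `g`, `π` form an exact sequence ending in a surjection onto a flat module, then `f`, `g`
stay exact after tensoring with any module. -/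
theorem LinearMap.lTensor_exact_of_exact_of_flat {R P₂ P₁ P₀ Y : Type*} [CommRing R]
    [AddCommGroup P₂] [Module R P₂] [AddCommGroup P₁] [Module R P₁] [AddCommGroup P₀] [Module R P₀]
    [AddCommGroup Y] [Module R Y] [Module.Flat R Y]
    {f : P₂ →ₗ[R] P₁} {g : P₁ →ₗ[R] P₀} {π : P₀ →ₗ[R] Y}
    (hfg : Function.Exact f g) (hgπ : Function.Exact g π) (hπ : Function.Surjective π)
    (M : Type*) [AddCommGroup M] [Module R M] :
    Function.Exact (f.lTensor M) (g.lTensor M) := by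
  have hinj : Function.Injective (g.range.subtype.lTensor M) :=
    LinearMap.lTensor_injective_of_exact_of_flat π hπ _ g.range.subtype_injective
      (LinearMap.exact_iff.2 (by rw [Submodule.range_subtype, LinearMap.exact_iff.1 hgπ])) M
  have h : Function.Exact (f.lTensor M) (g.rangeRestrict.lTensor M) :=
    lTensor_exact M (LinearMap.exact_iff.2 (by
      rw [LinearMap.ker_rangeRestrict, LinearMap.exact_iff.1 hfg])) g.surjective_rangeRestrict
  have hg : g.lTensor M = g.range.subtype.lTensor M ∘ₗ g.rangeRestrict.lTensor M := by
    rw [← LinearMap.lTensor_comp, LinearMap.subtype_comp_codRestrict]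
  rw [hg, LinearMap.coe_comp]
  exact h.comp_injective _ hinj (map_zero _)

/-- `TensorProduct.AlgebraTensorModule.cancelBaseChange` is natural in its first module. -/
theorem TensorProduct.AlgebraTensorModule.rTensor_cancelBaseChange {R S P Q : Type*}
    [CommRing R] [CommRing S] [Algebra R S] [AddCommGroup P] [Module R P] [Module S P] [IsScalarTower R S P]
    [AddCommGroup Q] [Module R Q] [Module S Q] [IsScalarTower R S Q] (k : P →ₗ[S] Q)
    (M : Type*) [AddCommGroup M] [Module R M] (x : P ⊗[S] (S ⊗[R] M)) :
    (k.restrictScalars R).rTensor M (AlgebraTensorModule.cancelBaseChange R S S P M x) =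
      AlgebraTensorModule.cancelBaseChange R S S Q M (k.rTensor (S ⊗[R] M) x) := by
  induction x with
  | zero => simp
  | add x y hx hy => simp only [map_add, hx, hy]
  | tmul p y =>
    induction y with
    | zero => simp
    | add x y hx hy => simp only [tmul_add, map_add, hx, hy]
    | tmul s m => simp

/-- Tensoring over `S` with a base change `S ⊗[R] M` is tensoring over `R` with `M`, so it preserves
the exactness of `f`, `g` as soon as tensoring over `R` does. -/
theorem LinearMap.lTensor_baseChange_exact {R S P₂ P₁ P₀ : Type*} [CommRing R] [CommRing S]
    [Algebra R S] [AddCommGroup P₂] [Module R P₂] [Module S P₂] [IsScalarTower R S P₂]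
    [AddCommGroup P₁] [Module R P₁] [Module S P₁] [IsScalarTower R S P₁]
    [AddCommGroup P₀] [Module R P₀] [Module S P₀] [IsScalarTower R S P₀]
    (f : P₂ →ₗ[S] P₁) (g : P₁ →ₗ[S] P₀) (M : Type*) [AddCommGroup M] [Module R M]
    (h : Function.Exact ((f.restrictScalars R).lTensor M) ((g.restrictScalars R).lTensor M)) :
    Function.Exact (f.lTensor (S ⊗[R] M)) (g.lTensor (S ⊗[R] M)) := by
  rw [← LinearMap.rTensor_exact_iff_lTensor_exact] at h ⊢
  refine (Function.Exact.iff_of_ladder_addEquiv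
    (AlgebraTensorModule.cancelBaseChange R S S P₂ M).toAddEquiv
    (AlgebraTensorModule.cancelBaseChange R S S P₁ M).toAddEquiv
    (AlgebraTensorModule.cancelBaseChange R S S P₀ M).toAddEquiv
    (f₁₂ := (f.rTensor (S ⊗[R] M)).toAddMonoidHom) (f₂₃ := (g.rTensor (S ⊗[R] M)).toAddMonoidHom)
    (g₁₂ := ((f.restrictScalars R).rTensor M).toAddMonoidHom)
    (g₂₃ := ((g.restrictScalars R).rTensor M).toAddMonoidHom) ?_ ?_).1 h
  · exact AddMonoidHom.ext (AlgebraTensorModule.rTensor_cancelBaseChange f M)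
  · exact AddMonoidHom.ext (AlgebraTensorModule.rTensor_cancelBaseChange g M)

/-- The base change of an `R`-module `M` to `S` has vanishing `Tor₁` against every `S`-module that
is flat over `R`. -/
theorem subsingleton_tor_one_baseChange_of_flat.{u} {R S : Type u} [CommRing R] [CommRing S]
    [Algebra R S] (M Y : Type u) [AddCommGroup M] [Module R M] [AddCommGroup Y] [Module S Y]
    [Module R Y] [IsScalarTower R S Y] [Module.Flat R Y] :
    Subsingleton (((Tor (ModuleCat.{u} S) 1).obj (ModuleCat.of S (S ⊗[R] M))).obj
      (ModuleCat.of S Y)) := by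
  let P := projectiveResolution (ModuleCat.of S Y)
  rw [← ModuleCat.isZero_iff_subsingleton]
  refine Limits.IsZero.of_iso ?_ (P.isoLeftDerivedObj
    ((MonoidalCategory.tensoringLeft (ModuleCat.{u} S)).obj (ModuleCat.of S (S ⊗[R] M))) 1)
  erw [← HomologicalComplex.exactAt_iff_isZero_homology]
  rw [HomologicalComplex.exactAt_iff' _ 2 1 0 (by simp) (by simp),
    ShortComplex.ShortExact.moduleCat_exact_iff_function_exact]
  have h₁ := (ShortComplex.ShortExact.moduleCat_exact_iff_function_exact _).1 (P.exact_succ 0)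
  have h₀ := (ShortComplex.ShortExact.moduleCat_exact_iff_function_exact _).1 P.exact₀
  have hπ : Function.Surjective (P.π.f 0) := (ModuleCat.epi_iff_surjective _).1 inferInstance
  let (n : ℕ) : Module R (P.complex.X n) := Module.compHom _ (algebraMap R S)
  have (n : ℕ) : IsScalarTower R S (P.complex.X n) := IsScalarTower.of_algebraMap_smul fun _ _ ↦ rfl
  exact LinearMap.lTensor_baseChange_exact (P.complex.d 2 1).hom (P.complex.d 1 0).hom M
    (LinearMap.lTensor_exact_of_exact_of_flat (f := (P.complex.d 2 1).hom.restrictScalars R)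
      (g := (P.complex.d 1 0).hom.restrictScalars R)
      (π := (show P.complex.X 0 →ₗ[S] Y from (P.π.f 0).hom).restrictScalars R) h₁ h₀ hπ M)

/-- Let `K` be a field, `A` and `B` two (commutative) `K`-algebras, `M` an
`A`-module and `N` a `B`-module.  Then `Tor₁^{A ⊗_K B}(M ⊗_K B, A ⊗_K N) = 0`.
Here `M ⊗_K B` is realized as the base change `(A ⊗_K B) ⊗_A M` and `A ⊗_K N` as the base
change `(A ⊗_K B) ⊗_B N`, with their natural `A ⊗_K B`-module structures. -/
theorem stmt2 (K : Type) [Field K] (A B : Type) [CommRing A] [CommRing B]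
    [Algebra K A] [Algebra K B]
    (M : Type) [AddCommGroup M] [Module A M]
    (N : Type) [AddCommGroup N] [Module B N] :
    Subsingleton
      ((((Tor (ModuleCat (A ⊗[K] B)) 1).obj
          (ModuleCat.of (A ⊗[K] B) ((A ⊗[K] B) ⊗[A] M))).obj
          (ModuleCat.of (A ⊗[K] B) ((A ⊗[K] B) ⊗[B] N)) : ModuleCat (A ⊗[K] B))) := by
  let : Module K N := Module.compHom N (algebraMap K B)
  have : IsScalarTower K B N := IsScalarTower.of_algebraMap_smul fun _ _ ↦ rfl
  have : Module.Flat A ((A ⊗[K] B) ⊗[B] N) :=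
    .of_linearEquiv (Algebra.IsPushout.cancelBaseChange K A B (A ⊗[K] B) N)
  exact subsingleton_tor_one_baseChange_of_flat M _
end
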